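/- For every natural number n, G(0, 0, n) = 1 if and only if n ≡ 2 (mod 4); in particular, the positions of Sprague–Grundy value 1 on the bottom row are periodic with period 4. -/

import Mathlib

namespace SharingNim

/-- The moves of three-pile Sharing Nim: take `k ≥ 1` tokens from one pile and add them to
another pile, provided the receiving pile has at most as many tokens as the source pile
after the move (i.e. `2 * k` is at most the difference of the two piles). -/
def moves : ℕ × ℕ × ℕ → Finset (ℕ × ℕ × ℕ)
  | (a, b, c) =>
    ((Finset.Icc 1 ((b - a) / 2)).image fun k => (a + k, b - k, c)) ∪
    ((Finset.Icc 1 ((a - b) / 2)).image fun k => (a - k, b + k, c)) ∪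
    ((Finset.Icc 1 ((c - a) / 2)).image fun k => (a + k, b, c - k)) ∪
    ((Finset.Icc 1 ((a - c) / 2)).image fun k => (a - k, b, c + k)) ∪
    ((Finset.Icc 1 ((c - b) / 2)).image fun k => (a, b + k, c - k)) ∪
    ((Finset.Icc 1 ((b - c) / 2)).image fun k => (a, b - k, c + k))

/-- The sum of squares of the pile sizes, a measure that strictly decreases along
every move. -/
def measure3 (p : ℕ × ℕ × ℕ) : ℕ := p.1 ^ 2 + p.2.1 ^ 2 + p.2.2 ^ 2

theorem sq_move_lt {x y k : ℕ} (hk : 1 ≤ k) (h : k ≤ (y - x) / 2) :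
    (x + k) ^ 2 + (y - k) ^ 2 < x ^ 2 + y ^ 2 := by
  have h1 : x + 2 * k ≤ y := by omega
  have h2 : k ≤ y := by omega
  zify [h2]
  nlinarith

theorem measure3_lt_of_mem_moves {q p : ℕ × ℕ × ℕ} (h : q ∈ moves p) :
    measure3 q < measure3 p := by
  obtain ⟨a, b, c⟩ := p
  simp only [moves, Finset.mem_union, Finset.mem_image, Finset.mem_Icc] at h
  rcases h with ((((⟨k, ⟨hk1, hk2⟩, rfl⟩ | ⟨k, ⟨hk1, hk2⟩, rfl⟩) | ⟨k, ⟨hk1, hk2⟩, rfl⟩) |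
      ⟨k, ⟨hk1, hk2⟩, rfl⟩) | ⟨k, ⟨hk1, hk2⟩, rfl⟩) | ⟨k, ⟨hk1, hk2⟩, rfl⟩ <;>
    simp only [measure3] <;>
    [linarith [sq_move_lt (x := a) (y := b) hk1 hk2];
     linarith [sq_move_lt (x := b) (y := a) hk1 hk2];
     linarith [sq_move_lt (x := a) (y := c) hk1 hk2];
     linarith [sq_move_lt (x := c) (y := a) hk1 hk2];
     linarith [sq_move_lt (x := b) (y := c) hk1 hk2];
     linarith [sq_move_lt (x := c) (y := b) hk1 hk2]]

/-- The minimum excludant of a finite set of naturals. -/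
noncomputable def mex (s : Finset ℕ) : ℕ := sInf {n : ℕ | n ∉ s}

/-- The Sprague–Grundy value of a position of three-pile Sharing Nim: the minimum
excludant of the Sprague–Grundy values of the positions reachable in one move. -/
noncomputable def G (p : ℕ × ℕ × ℕ) : ℕ :=
  mex ((moves p).attach.image fun q => G q.1)
termination_by measure3 p
decreasing_by exact measure3_lt_of_mem_moves q.2

def E (d : ℕ) : Prop := Even (padicValNat 2 d)

theorem E_two (k : ℕ) (hk : k ≠ 0) : E (2 * k) ↔ ¬ E k := by
  unfold E
  rw [padicValNat.mul (by norm_num) hk, padicValNat_self, add_comm, Nat.even_add_one]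

theorem E_zero : E 0 := by simp [E]

theorem E_odd (k : ℕ) (hk : k % 2 = 1) : E k := by
  unfold E
  rw [padicValNat.eq_zero_of_not_dvd (by omega)]
  exact Even.zero

theorem E_clash (x y : ℕ) (hx : E x) (hy : E y) (h : y = 2 * x) : x = 0 := by
  by_contra h0
  subst h
  exact (E_two x h0).1 hy hx

theorem E_half (d : ℕ) (h : ¬ E d) : d ≠ 0 ∧ d % 2 = 0 ∧ E (d / 2) := by
  have h0 : d ≠ 0 := by rintro rfl; exact h E_zero
  have h1 : d % 2 = 0 := by
    by_contra h1
    exact h (E_odd d (by omega))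
  refine ⟨h0, h1, ?_⟩
  by_contra h2
  have := (E_two (d / 2) (by omega)).2 h2
  rw [show 2 * (d / 2) = d by omega] at this
  exact h this

theorem E_mod (d : ℕ) (h : E d) : d % 4 ≠ 2 := by
  intro h1
  have := E_clash (d / 2) d (E_odd _ (by omega)) h (by omega)
  omega

theorem not_E_mod (d : ℕ) (h : ¬ E d) : d % 8 = 0 ∨ d % 4 = 2 := by
  obtain ⟨h0, h1, h2⟩ := E_half d h
  have := E_mod _ h2
  by_contra h3
  have h4 : ¬ E (d / 2) := by
    have := (E_two (d / 2 / 2) (by omega))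
    rw [show 2 * (d / 2 / 2) = d / 2 by omega] at this
    rw [this, not_not]
    exact E_odd _ (by omega)
  exact h4 h2

/-- Absolute difference. -/
def ds (a b : ℕ) : ℕ := (a - b) + (b - a)

def P (p : ℕ × ℕ × ℕ) : Prop :=
  (p.1 = p.2.1 ∧ E (ds p.1 p.2.2)) ∨ (p.1 = p.2.2 ∧ E (ds p.1 p.2.1)) ∨
    (p.2.1 = p.2.2 ∧ E (ds p.1 p.2.1))

/-- Value one for sorted positions. -/
def T (a b c : ℕ) : Prop :=
  a ≤ b ∧ b ≤ c ∧ ((b = a ∧ (c - b) % 4 = 2) ∨ (c = b ∧ (b - a) % 4 = 2) ∨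
    (b = a + 1 ∧ c = b + 1) ∨ (b = a + 2 ∧ (c - b) % 4 = 3) ∨ (c = b + 2 ∧ (b - a) % 4 = 3))

def S (p : ℕ × ℕ × ℕ) : Prop :=
  T p.1 p.2.1 p.2.2 ∨ T p.1 p.2.2 p.2.1 ∨ T p.2.1 p.1 p.2.2 ∨ T p.2.1 p.2.2 p.1 ∨
    T p.2.2 p.1 p.2.1 ∨ T p.2.2 p.2.1 p.1

theorem mem_moves (a b c : ℕ) (q : ℕ × ℕ × ℕ) : q ∈ moves (a, b, c) ↔
    ∃ k, 1 ≤ k ∧ ((a + 2 * k ≤ b ∧ q = (a + k, b - k, c)) ∨ (b + 2 * k ≤ a ∧ q = (a - k, b + k, c)) ∨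
      (a + 2 * k ≤ c ∧ q = (a + k, b, c - k)) ∨ (c + 2 * k ≤ a ∧ q = (a - k, b, c + k)) ∨
      (b + 2 * k ≤ c ∧ q = (a, b + k, c - k)) ∨ (c + 2 * k ≤ b ∧ q = (a, b - k, c + k))) := by
  simp only [moves, Finset.mem_union, Finset.mem_image, Finset.mem_Icc]
  constructor
  · rintro (((((⟨k, ⟨h1, h2⟩, rfl⟩ | ⟨k, ⟨h1, h2⟩, rfl⟩) | ⟨k, ⟨h1, h2⟩, rfl⟩) |
      ⟨k, ⟨h1, h2⟩, rfl⟩) | ⟨k, ⟨h1, h2⟩, rfl⟩) | ⟨k, ⟨h1, h2⟩, rfl⟩)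
    · exact ⟨k, h1, Or.inl ⟨by omega, rfl⟩⟩
    · exact ⟨k, h1, Or.inr (Or.inl ⟨by omega, rfl⟩)⟩
    · exact ⟨k, h1, Or.inr (Or.inr (Or.inl ⟨by omega, rfl⟩))⟩
    · exact ⟨k, h1, Or.inr (Or.inr (Or.inr (Or.inl ⟨by omega, rfl⟩)))⟩
    · exact ⟨k, h1, Or.inr (Or.inr (Or.inr (Or.inr (Or.inl ⟨by omega, rfl⟩))))⟩
    · exact ⟨k, h1, Or.inr (Or.inr (Or.inr (Or.inr (Or.inr ⟨by omega, rfl⟩))))⟩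
  · rintro ⟨k, h1, ⟨h2, rfl⟩ | ⟨h2, rfl⟩ | ⟨h2, rfl⟩ | ⟨h2, rfl⟩ | ⟨h2, rfl⟩ | ⟨h2, rfl⟩⟩
    · exact Or.inl (Or.inl (Or.inl (Or.inl (Or.inl ⟨k, ⟨h1, by omega⟩, rfl⟩))))
    · exact Or.inl (Or.inl (Or.inl (Or.inl (Or.inr ⟨k, ⟨h1, by omega⟩, rfl⟩))))
    · exact Or.inl (Or.inl (Or.inl (Or.inr ⟨k, ⟨h1, by omega⟩, rfl⟩)))
    · exact Or.inl (Or.inl (Or.inr ⟨k, ⟨h1, by omega⟩, rfl⟩))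
    · exact Or.inl (Or.inr ⟨k, ⟨h1, by omega⟩, rfl⟩)
    · exact Or.inr ⟨k, ⟨h1, by omega⟩, rfl⟩

theorem moves_swap12 {a b c a' b' c' : ℕ} (h : (a', b', c') ∈ moves (a, b, c)) :
    (b', a', c') ∈ moves (b, a, c) := by
  rw [mem_moves] at h ⊢
  obtain ⟨k, h1, h⟩ := h
  refine ⟨k, h1, ?_⟩
  simp only [Prod.mk.injEq] at h ⊢
  rcases h with ⟨h, rfl, rfl, rfl⟩ | ⟨h, rfl, rfl, rfl⟩ | ⟨h, rfl, rfl, rfl⟩ |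
    ⟨h, rfl, rfl, rfl⟩ | ⟨h, rfl, rfl, rfl⟩ | ⟨h, rfl, rfl, rfl⟩
  · exact Or.inr (Or.inl ⟨h, rfl, rfl, rfl⟩)
  · exact Or.inl ⟨h, rfl, rfl, rfl⟩
  · exact Or.inr (Or.inr (Or.inr (Or.inr (Or.inl ⟨h, rfl, rfl, rfl⟩))))
  · exact Or.inr (Or.inr (Or.inr (Or.inr (Or.inr ⟨h, rfl, rfl, rfl⟩))))
  · exact Or.inr (Or.inr (Or.inl ⟨h, rfl, rfl, rfl⟩))
  · exact Or.inr (Or.inr (Or.inr (Or.inl ⟨h, rfl, rfl, rfl⟩)))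

theorem moves_swap23 {a b c a' b' c' : ℕ} (h : (a', b', c') ∈ moves (a, b, c)) :
    (a', c', b') ∈ moves (a, c, b) := by
  rw [mem_moves] at h ⊢
  obtain ⟨k, h1, h⟩ := h
  refine ⟨k, h1, ?_⟩
  simp only [Prod.mk.injEq] at h ⊢
  rcases h with ⟨h, rfl, rfl, rfl⟩ | ⟨h, rfl, rfl, rfl⟩ | ⟨h, rfl, rfl, rfl⟩ |
    ⟨h, rfl, rfl, rfl⟩ | ⟨h, rfl, rfl, rfl⟩ | ⟨h, rfl, rfl, rfl⟩
  · exact Or.inr (Or.inr (Or.inl ⟨h, rfl, rfl, rfl⟩))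
  · exact Or.inr (Or.inr (Or.inr (Or.inl ⟨h, rfl, rfl, rfl⟩)))
  · exact Or.inl ⟨h, rfl, rfl, rfl⟩
  · exact Or.inr (Or.inl ⟨h, rfl, rfl, rfl⟩)
  · exact Or.inr (Or.inr (Or.inr (Or.inr (Or.inr ⟨h, rfl, rfl, rfl⟩))))
  · exact Or.inr (Or.inr (Or.inr (Or.inr (Or.inl ⟨h, rfl, rfl, rfl⟩))))

theorem ds_comm (a b : ℕ) : ds a b = ds b a := by unfold ds; omega

theorem P_swap12 {a b c : ℕ} (h : P (a, b, c)) : P (b, a, c) := by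
  simp only [P] at h ⊢
  rcases h with ⟨rfl, h⟩ | ⟨rfl, h⟩ | ⟨rfl, h⟩
  · exact Or.inl ⟨rfl, h⟩
  · exact Or.inr (Or.inr ⟨rfl, by rwa [ds_comm]⟩)
  · exact Or.inr (Or.inl ⟨rfl, by rwa [ds_comm]⟩)

theorem P_swap23 {a b c : ℕ} (h : P (a, b, c)) : P (a, c, b) := by
  simp only [P] at h ⊢
  rcases h with ⟨rfl, h⟩ | ⟨rfl, h⟩ | ⟨rfl, h⟩
  · exact Or.inr (Or.inl ⟨rfl, h⟩)
  · exact Or.inl ⟨rfl, h⟩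
  · exact Or.inr (Or.inr ⟨rfl, h⟩)

theorem S_swap12 {a b c : ℕ} (h : S (a, b, c)) : S (b, a, c) := by
  simp only [S] at h ⊢
  tauto

theorem S_swap23 {a b c : ℕ} (h : S (a, b, c)) : S (a, c, b) := by
  simp only [S] at h ⊢
  tauto

/-- Reduction to sorted triples. -/
theorem sort_ind (Q : ℕ → ℕ → ℕ → Prop) (h12 : ∀ a b c, Q a b c → Q b a c)
    (h23 : ∀ a b c, Q a b c → Q a c b) (h : ∀ a b c, a ≤ b → b ≤ c → Q a b c) (a b c : ℕ) :
    Q a b c := by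
  rcases le_total a b with h1 | h1 <;> rcases le_total b c with h2 | h2 <;>
    rcases le_total a c with h3 | h3
  · exact h _ _ _ h1 h2
  · exact h _ _ _ h1 h2
  · exact h23 _ _ _ (h _ _ _ h3 h2)
  · exact h23 _ _ _ (h12 _ _ _ (h _ _ _ h3 h1))
  · exact h12 _ _ _ (h _ _ _ h1 h3)
  · exact h12 _ _ _ (h23 _ _ _ (h _ _ _ h2 h3))
  · exact h12 _ _ _ (h _ _ _ h1 h3)
  · exact h12 _ _ _ (h23 _ _ _ (h12 _ _ _ (h _ _ _ h2 h1)))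

set_option maxHeartbeats 4000000 in
theorem P_P {p q : ℕ × ℕ × ℕ} (hp : P p) (hq : q ∈ moves p) : ¬ P q := by
  obtain ⟨a, b, c⟩ := p
  rw [mem_moves] at hq
  obtain ⟨k, hk, hq⟩ := hq
  intro hP
  rcases hq with ⟨h2, rfl⟩ | ⟨h2, rfl⟩ | ⟨h2, rfl⟩ | ⟨h2, rfl⟩ | ⟨h2, rfl⟩ | ⟨h2, rfl⟩ <;>
  simp only [P, ds] at hp hP <;>
  rcases hp with ⟨h3, h4⟩ | ⟨h3, h4⟩ | ⟨h3, h4⟩ <;>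
  rcases hP with ⟨h5, h6⟩ | ⟨h5, h6⟩ | ⟨h5, h6⟩ <;>
  first
  | omega
  | (have := E_clash _ _ h6 h4 (by omega); omega)

set_option maxHeartbeats 4000000 in
theorem P_ex_sorted (a b c : ℕ) (hab : a ≤ b) (hbc : b ≤ c) (h : ¬ P (a, b, c)) :
    ∃ a' b' c', (a', b', c') ∈ moves (a, b, c) ∧ P (a', b', c') := by
  by_cases h1 : a = b
  · subst h1
    have h2 : ¬ E (c - a) := fun h2 => h (Or.inl ⟨rfl, by
      simp only [ds]; rwa [show a - c + (c - a) = c - a by omega]⟩)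
    obtain ⟨h0, h3, h4⟩ := E_half _ h2
    refine ⟨a, a + (c - a) / 2, c - (c - a) / 2, (mem_moves _ _ _ _).2 ⟨(c - a) / 2, by omega, Or.inr (Or.inr (Or.inr (Or.inr (Or.inl ⟨by omega, rfl⟩))))⟩,
      Or.inr (Or.inr ⟨by simp only []; omega, ?_⟩)⟩
    simp only [ds]
    convert h4 using 1; omega
  by_cases h1' : b = c
  · subst h1'
    have h2 : ¬ E (b - a) := fun h2 => h (Or.inr (Or.inr ⟨rfl, by
      simp only [ds]; rwa [show a - b + (b - a) = b - a by omega]⟩))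
    obtain ⟨h0, h3, h4⟩ := E_half _ h2
    refine ⟨a + (b - a) / 2, b - (b - a) / 2, b, (mem_moves _ _ _ _).2 ⟨(b - a) / 2, by omega, Or.inl ⟨by omega, rfl⟩⟩,
      Or.inl ⟨by simp only []; omega, ?_⟩⟩
    simp only [ds]
    convert h4 using 1; omega
  by_cases h2 : E (ds (b - a) (c - b))
  · rcases le_total (b - a) (c - b) with h3 | h3
    · refine ⟨b, b, c - (b - a), (mem_moves _ _ _ _).2 ⟨b - a, by omega, Or.inr (Or.inr (Or.inl ⟨by omega, by
        rw [show a + (b - a) = b by omega]⟩))⟩, Or.inl ⟨rfl, ?_⟩⟩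
      simp only [ds] at h2 ⊢
      convert h2 using 1; omega
    · refine ⟨a + (c - b), b, b, (mem_moves _ _ _ _).2 ⟨c - b, by omega, Or.inr (Or.inr (Or.inl ⟨by omega, by
        rw [show c - (c - b) = b by omega]⟩))⟩, Or.inr (Or.inr ⟨rfl, ?_⟩)⟩
      simp only [ds] at h2 ⊢
      convert h2 using 1; omega
  · obtain ⟨h0, h3, h4⟩ := E_half _ h2
    have hm : ∃ m, ds (b - a) (c - b) = 2 * m := ⟨ds (b - a) (c - b) / 2, by omega⟩
    obtain ⟨m, hm⟩ := hm
    rw [hm, Nat.mul_div_cancel_left _ (by norm_num)] at h4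
    rw [hm] at h0
    have hc : b - a = c - b + 2 * m ∨ c - b = b - a + 2 * m := by unfold ds at hm; omega
    clear hm h2 h3 h
    refine ⟨a + (c - a) / 2, b, c - (c - a) / 2, (mem_moves _ _ _ _).2 ⟨(c - a) / 2, by omega,
      Or.inr (Or.inr (Or.inl ⟨by omega, rfl⟩))⟩, Or.inr (Or.inl ⟨?_, ?_⟩)⟩
    · simp only []
      omega
    · have : ds (a + (c - a) / 2) b = m := by
        unfold ds
        rcases hc with hc | hc <;> omega
      simp only [this]
      exact h4

theorem P_ex {p : ℕ × ℕ × ℕ} (hp : ¬ P p) : ∃ q ∈ moves p, P q := by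
  have := sort_ind (fun a b c => ¬ P (a, b, c) →
    ∃ a' b' c', (a', b', c') ∈ moves (a, b, c) ∧ P (a', b', c')) ?_ ?_ P_ex_sorted p.1 p.2.1 p.2.2 hp
  · obtain ⟨a, b, c, h1, h2⟩ := this
    exact ⟨(a, b, c), h1, h2⟩
  · intro a b c h h'
    obtain ⟨x, y, z, h1, h2⟩ := h (fun h => h' (P_swap12 h))
    exact ⟨_, _, _, moves_swap12 h1, P_swap12 h2⟩
  · intro a b c h h'
    obtain ⟨x, y, z, h1, h2⟩ := h (fun h => h' (P_swap23 h))
    exact ⟨_, _, _, moves_swap23 h1, P_swap23 h2⟩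

theorem S_not_P {p : ℕ × ℕ × ℕ} (h : S p) : ¬ P p := by
  obtain ⟨a, b, c⟩ := p
  simp only [S, P, T] at h ⊢
  rintro (⟨h1, h2⟩ | ⟨h1, h2⟩ | ⟨h1, h2⟩) <;>
  · have := E_mod _ h2
    simp only [ds] at this
    rcases h with h | h | h | h | h | h <;> omega

set_option maxHeartbeats 4000000 in
theorem S_S_sorted (a b c : ℕ) (h : T a b c) :
    ∀ a' b' c', (a', b', c') ∈ moves (a, b, c) → ¬ S (a', b', c') := by
  intro a' b' c' hq
  rw [mem_moves] at hq
  obtain ⟨k, hk, hq⟩ := hq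
  simp only [Prod.mk.injEq] at hq
  simp only [S, T] at h ⊢
  obtain ⟨h1, h2, h⟩ := h
  rcases hq with h3 | h3 | h3 | h3 | h3 | h3 <;> obtain ⟨h3, rfl, rfl, rfl⟩ := h3 <;>
  rcases h with h | h | h | h | h <;>
  rintro (h4 | h4 | h4 | h4 | h4 | h4) <;> omega

theorem S_sorted {a b c : ℕ} (hab : a ≤ b) (hbc : b ≤ c) (h : S (a, b, c)) : T a b c := by
  simp only [S, T] at h ⊢
  rcases h with h | h | h | h | h | h <;> omega

theorem S_S {p q : ℕ × ℕ × ℕ} (hp : S p) (hq : q ∈ moves p) : ¬ S q := by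
  have := sort_ind (fun a b c => S (a, b, c) →
    ∀ a' b' c', (a', b', c') ∈ moves (a, b, c) → ¬ S (a', b', c')) ?_ ?_
    (fun a b c h1 h2 h => S_S_sorted a b c (S_sorted h1 h2 h)) p.1 p.2.1 p.2.2 hp
  · exact this q.1 q.2.1 q.2.2 hq
  · intro a b c h h' x y z hm hs
    exact h (S_swap12 h') _ _ _ (moves_swap12 hm) (S_swap12 hs)
  · intro a b c h h' x y z hm hs
    exact h (S_swap23 h') _ _ _ (moves_swap23 hm) (S_swap23 hs)

/-- Moves from a sorted triple. -/
theorem mv_ca {a b c : ℕ} (k : ℕ) (hk : 1 ≤ k) (h : a + 2 * k ≤ c)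
    (hS : S (a + k, b, c - k)) : ∃ a' b' c', (a', b', c') ∈ moves (a, b, c) ∧ S (a', b', c') :=
  ⟨_, _, _, (mem_moves _ _ _ _).2 ⟨k, hk, Or.inr (Or.inr (Or.inl ⟨h, rfl⟩))⟩, hS⟩

theorem mv_cb {a b c : ℕ} (k : ℕ) (hk : 1 ≤ k) (h : b + 2 * k ≤ c)
    (hS : S (a, b + k, c - k)) : ∃ a' b' c', (a', b', c') ∈ moves (a, b, c) ∧ S (a', b', c') :=
  ⟨_, _, _, (mem_moves _ _ _ _).2 ⟨k, hk, Or.inr (Or.inr (Or.inr (Or.inr (Or.inl ⟨h, rfl⟩))))⟩, hS⟩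

theorem mv_ba {a b c : ℕ} (k : ℕ) (hk : 1 ≤ k) (h : a + 2 * k ≤ b)
    (hS : S (a + k, b - k, c)) : ∃ a' b' c', (a', b', c') ∈ moves (a, b, c) ∧ S (a', b', c') :=
  ⟨_, _, _, (mem_moves _ _ _ _).2 ⟨k, hk, Or.inl ⟨h, rfl⟩⟩, hS⟩

/-- The relevant orders of the resulting triple. -/
theorem S_of_123 {a b c : ℕ} (h : T a b c) : S (a, b, c) := Or.inl h
theorem S_of_213 {a b c : ℕ} (h : T b a c) : S (a, b, c) := Or.inr (Or.inr (Or.inl h))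
theorem S_of_132 {a b c : ℕ} (h : T a c b) : S (a, b, c) := Or.inr (Or.inl h)

set_option maxHeartbeats 4000000 in
theorem S_ex_sorted (a b c : ℕ) (hab : a ≤ b) (hbc : b ≤ c) (hP : ¬ P (a, b, c))
    (hS : ¬ S (a, b, c)) : ∃ a' b' c', (a', b', c') ∈ moves (a, b, c) ∧ S (a', b', c') := by
  have hT : ¬ T a b c := fun h => hS (Or.inl h)
  simp only [T] at hT
  by_cases h1 : a = b
  · subst h1
    have h2 : ¬ E (ds a c) := fun h2 => hP (Or.inl ⟨rfl, h2⟩)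
    have h0 := (E_half _ h2).1
    have h3 := not_E_mod _ h2
    simp only [ds] at h0 h3
    have h4 : (c - a) % 8 = 0 := by omega
    clear h3 hT
    exact mv_cb ((c - a) / 2 - 1) (by omega) (by omega) (S_of_123 ⟨by omega, by omega,
            Or.inr (Or.inr (Or.inr (Or.inr ⟨by omega, by omega⟩)))⟩)
  by_cases h1' : b = c
  · subst h1'
    have h2 : ¬ E (ds a b) := fun h2 => hP (Or.inr (Or.inr ⟨rfl, h2⟩))
    have h0 := (E_half _ h2).1
    have h3 := not_E_mod _ h2
    simp only [ds] at h0 h3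
    have h4 : (b - a) % 8 = 0 := by omega
    clear h3 hT
    exact mv_ba ((b - a) / 2 - 1) (by omega) (by omega) (S_of_123 ⟨by omega, by omega,
            Or.inr (Or.inr (Or.inr (Or.inl ⟨by omega, by omega⟩)))⟩)
  obtain ⟨x, rfl⟩ := Nat.exists_eq_add_of_le hab
  obtain ⟨y, rfl⟩ := Nat.exists_eq_add_of_le hbc
  have hA : ¬ (x = 1 ∧ y = 1) := by omega
  have hB : ¬ (x = 2 ∧ y % 4 = 3) := by omega
  have hC : ¬ (y = 2 ∧ x % 4 = 3) := by omega
  clear hP hS hab hbc hT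
  rcases le_total x y with hxy | hxy
  · obtain ⟨D, rfl⟩ := Nat.exists_eq_add_of_le hxy
    have hc : D % 4 = 2 ∨ D % 4 = 1 ∨ D % 4 = 3 ∨ D % 8 = 4 ∨ D % 8 = 0 := by omega
    rcases hc with hD | hD | hD | hD | hD
    · exact mv_ca x (by omega) (by omega) (S_of_123 ⟨by omega, by omega,
            Or.inl ⟨by omega, by omega⟩⟩)
    · by_cases hx : x = 1
      · subst hx
        by_cases h8 : (1 + D) % 8 = 2
        · exact mv_cb ((1 + D) / 2) (by omega) (by omega) (S_of_123 ⟨by omega, by omega,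
            Or.inr (Or.inl ⟨by omega, by omega⟩)⟩)
        · exact mv_cb ((1 + D) / 2 - 1) (by omega) (by omega) (S_of_123 ⟨by omega, by omega,
            Or.inr (Or.inr (Or.inr (Or.inr ⟨by omega, by omega⟩)))⟩)
      · exact mv_ca (x - 2) (by omega) (by omega) (S_of_123 ⟨by omega, by omega,
            Or.inr (Or.inr (Or.inr (Or.inl ⟨by omega, by omega⟩)))⟩)
    · by_cases h3 : D = 3
      · exact mv_ca (x + 1) (by omega) (by omega) (S_of_213 ⟨by omega, by omega,
            Or.inr (Or.inr (Or.inl ⟨by omega, by omega⟩))⟩)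
      · exact mv_ca (x + 2) (by omega) (by omega) (S_of_213 ⟨by omega, by omega,
            Or.inr (Or.inr (Or.inr (Or.inl ⟨by omega, by omega⟩)))⟩)
    · exact mv_ca (x + D / 2) (by omega) (by omega) (S_of_213 ⟨by omega, by omega,
            Or.inr (Or.inl ⟨by omega, by omega⟩)⟩)
    · by_cases h0 : D = 0
      · exact mv_ca (x - 1) (by omega) (by omega) (S_of_123 ⟨by omega, by omega,
            Or.inr (Or.inr (Or.inl ⟨by omega, by omega⟩))⟩)
      · exact mv_ca (x + (D / 2 - 1)) (by omega) (by omega) (S_of_213 ⟨by omega, by omega,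
            Or.inr (Or.inr (Or.inr (Or.inr ⟨by omega, by omega⟩)))⟩)
  · obtain ⟨D, rfl⟩ := Nat.exists_eq_add_of_le hxy
    have hc : D % 4 = 2 ∨ D % 4 = 1 ∨ D % 4 = 3 ∨ D % 8 = 4 ∨ D % 8 = 0 := by omega
    rcases hc with hD | hD | hD | hD | hD
    · exact mv_ca y (by omega) (by omega) (S_of_123 ⟨by omega, by omega,
            Or.inr (Or.inl ⟨by omega, by omega⟩)⟩)
    · by_cases hx : y = 1
      · subst hx
        by_cases h8 : (1 + D) % 8 = 2
        · exact mv_ba ((1 + D) / 2) (by omega) (by omega) (S_of_123 ⟨by omega, by omega,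
            Or.inl ⟨by omega, by omega⟩⟩)
        · exact mv_ba ((1 + D) / 2 - 1) (by omega) (by omega) (S_of_123 ⟨by omega, by omega,
            Or.inr (Or.inr (Or.inr (Or.inl ⟨by omega, by omega⟩)))⟩)
      · exact mv_ca (y - 2) (by omega) (by omega) (S_of_123 ⟨by omega, by omega,
            Or.inr (Or.inr (Or.inr (Or.inr ⟨by omega, by omega⟩)))⟩)
    · by_cases h3 : D = 3
      · exact mv_ca (y + 1) (by omega) (by omega) (S_of_132 ⟨by omega, by omega,
            Or.inr (Or.inr (Or.inl ⟨by omega, by omega⟩))⟩)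
      · exact mv_ca (y + 2) (by omega) (by omega) (S_of_132 ⟨by omega, by omega,
            Or.inr (Or.inr (Or.inr (Or.inr ⟨by omega, by omega⟩)))⟩)
    · exact mv_ca (y + D / 2) (by omega) (by omega) (S_of_132 ⟨by omega, by omega,
            Or.inl ⟨by omega, by omega⟩⟩)
    · by_cases h0 : D = 0
      · exact mv_ca (y - 1) (by omega) (by omega) (S_of_123 ⟨by omega, by omega,
            Or.inr (Or.inr (Or.inl ⟨by omega, by omega⟩))⟩)
      · exact mv_ca (y + (D / 2 - 1)) (by omega) (by omega) (S_of_132 ⟨by omega, by omega,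
            Or.inr (Or.inr (Or.inr (Or.inl ⟨by omega, by omega⟩)))⟩)

theorem S_ex {p : ℕ × ℕ × ℕ} (hp : ¬ P p) (hs : ¬ S p) : ∃ q ∈ moves p, S q := by
  have := sort_ind (fun a b c => ¬ P (a, b, c) → ¬ S (a, b, c) →
    ∃ a' b' c', (a', b', c') ∈ moves (a, b, c) ∧ S (a', b', c')) ?_ ?_ S_ex_sorted
    p.1 p.2.1 p.2.2 hp hs
  · obtain ⟨a, b, c, h1, h2⟩ := this
    exact ⟨(a, b, c), h1, h2⟩
  · intro a b c h h' hs
    obtain ⟨x, y, z, h1, h2⟩ := h (fun h => h' (P_swap12 h)) (fun h => hs (S_swap12 h))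
    exact ⟨_, _, _, moves_swap12 h1, S_swap12 h2⟩
  · intro a b c h h' hs
    obtain ⟨x, y, z, h1, h2⟩ := h (fun h => h' (P_swap23 h)) (fun h => hs (S_swap23 h))
    exact ⟨_, _, _, moves_swap23 h1, S_swap23 h2⟩

theorem mex_notMem (s : Finset ℕ) : mex s ∉ s := by
  have : {n : ℕ | n ∉ s}.Nonempty := Infinite.exists_notMem_finset s
  exact Nat.sInf_mem this

theorem mem_of_lt_mex {s : Finset ℕ} {m : ℕ} (h : m < mex s) : m ∈ s := by
  by_contra h1
  exact absurd (Nat.sInf_le (s := {n : ℕ | n ∉ s}) h1) (not_le.2 h)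

theorem G_ne {p q : ℕ × ℕ × ℕ} (h : q ∈ moves p) : G q ≠ G p := by
  intro h1
  rw [G.eq_1 p] at h1
  apply mex_notMem ((moves p).attach.image fun q => G q.1)
  rw [← h1]
  exact Finset.mem_image.2 ⟨⟨q, h⟩, Finset.mem_attach _ _, rfl⟩

theorem G_ex {p : ℕ × ℕ × ℕ} {m : ℕ} (h : m < G p) : ∃ q ∈ moves p, G q = m := by
  rw [G.eq_1 p] at h
  obtain ⟨⟨q, hq⟩, -, h2⟩ := Finset.mem_image.1 (mem_of_lt_mex h)
  exact ⟨q, hq, h2⟩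

theorem G_char (n : ℕ) : ∀ p, measure3 p = n → (G p = 0 ↔ P p) ∧ (G p = 1 ↔ S p) := by
  induction n using Nat.strong_induction_on with
  | _ n ih =>
  rintro p rfl
  have ih' : ∀ q ∈ moves p, (G q = 0 ↔ P q) ∧ (G q = 1 ↔ S q) := fun q hq =>
    ih _ (measure3_lt_of_mem_moves hq) q rfl
  have h0 : G p = 0 ↔ P p := by
    constructor
    · intro h
      by_contra hP
      obtain ⟨q, hq, h1⟩ := P_ex hP
      exact G_ne hq ((((ih' q hq).1).2 h1).trans h.symm)
    · intro hP
      by_contra h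
      obtain ⟨q, hq, h1⟩ := G_ex (Nat.pos_of_ne_zero h)
      exact P_P hP hq (((ih' q hq).1).1 h1)
  refine ⟨h0, ?_, ?_⟩
  · intro h
    by_contra hS
    have hP : ¬ P p := fun hP => by
      rw [h0.2 hP] at h
      exact absurd h (by norm_num)
    obtain ⟨q, hq, h1⟩ := S_ex hP hS
    exact G_ne hq ((((ih' q hq).2).2 h1).trans h.symm)
  · intro hS
    have hne : G p ≠ 0 := fun h => S_not_P hS (h0.1 h)
    by_contra h
    obtain ⟨q, hq, h1⟩ := G_ex (p := p) (m := 1) (by omega)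
    exact S_S hS hq (((ih' q hq).2).1 h1)

/-- `G(0,0,n) = 1` iff `n ≡ 2 (mod 4)`. -/
theorem grundy_one_bottom_row (n : ℕ) :
    G (0, 0, n) = 1 ↔ n % 4 = 2 := by
  rw [(G_char _ _ rfl).2]
  constructor
  · intro h
    have := S_sorted (le_refl 0) (Nat.zero_le n) h
    unfold T at this
    omega
  · intro h
    exact Or.inl ⟨le_refl 0, Nat.zero_le n, Or.inl ⟨rfl, by omega⟩⟩

end SharingNim
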